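/- Let N ≥ 2, let p = (p_1,…,p_s) consist of s distinct primes, and let γ = (γ_j)_{j≥1} be a non-increasing sequence of weights with 1 ≥ γ_1 ≥ γ_2 ≥ … > 0. Then there exists a p-adic shift σ ∈ [0,1)^s such that e²_{N,s}(H_{p,N} ⊕_p σ) ≤ (1/N²) [ Π_{j=1}^s (1 + γ_j (log N) p_j²/log p_j) + Π_{j=1}^s (1 + γ_j/2) · Π_{j=1}^s (1 + γ_j p_j/6) ]. -/

import Mathlib

open MeasureTheory Finset

/-- The digit of `x ∈ [0,1)` at base-`p` position `r` (the coefficient of `p^{-(r+1)}`),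
using the finite expansion for `p`-adic rationals. -/
noncomputable def rdigit (p : ℕ) (x : ℝ) (r : ℕ) : ℕ :=
  (⌊x * (p : ℝ) ^ (r + 1)⌋).toNat % p

/-- The value of the `p`-adic integer `φ_p^+(x)` modulo `p^m`, as a natural number. -/
noncomputable def truncVal (p : ℕ) (x : ℝ) (m : ℕ) : ℕ :=
  ∑ r ∈ Finset.range m, rdigit p x r * p ^ r

/-- Digit `r` of the `p`-adic sum `φ_p^+(x) +_{ℤ_p} φ_p^+(σ)`. -/
noncomputable def sdigit (p : ℕ) (x σ : ℝ) (r : ℕ) : ℕ :=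
  (truncVal p x (r + 1) + truncVal p σ (r + 1)) % p ^ (r + 1) / p ^ r

/-- The `p`-adic shift `x ⊕_p σ = φ_p(φ_p^+(x) +_{ℤ_p} φ_p^+(σ))` (the Monna map applied to
the `p`-adic sum, taken mod 1). -/
noncomputable def pshift (p : ℕ) (x σ : ℝ) : ℝ :=
  Int.fract (∑' r : ℕ, (sdigit p x σ r : ℝ) / (p : ℝ) ^ (r + 1))

/-- The simplified `p`-adic shift `x ⊕_{p,m}^{simp} σ`: the truncation of `x ⊕_p σ` to its `m`
most significant base-`p` digits. -/
noncomputable def simpShift (p m : ℕ) (x σ : ℝ) : ℝ :=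
  ∑ r ∈ Finset.range m, (sdigit p x σ r : ℝ) / (p : ℝ) ^ (r + 1)

/-- The mid-simplified `p`-adic shift `x ⊕_{p,m}^{simi} σ = (x ⊕_{p,m}^{simp} σ) + 1/(2p^m)`. -/
noncomputable def midShift (p m : ℕ) (x σ : ℝ) : ℝ :=
  simpShift p m x σ + 1 / (2 * (p : ℝ) ^ m)

/-- The radical inverse function `φ_p(n) = Σ_r n_r p^{-(r+1)}` in base `p`. -/
noncomputable def radInv (p n : ℕ) : ℝ :=
  ∑' r : ℕ, ((n / p ^ r % p : ℕ) : ℝ) / (p : ℝ) ^ (r + 1)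

/-- Membership in `ℚ(p^m) = {a p^{-m} : a = 0,1,…,p^m - 1}`. -/
def QSet (p m : ℕ) (x : ℝ) : Prop :=
  ∃ a : ℕ, a < p ^ m ∧ x = (a : ℝ) / (p : ℝ) ^ m

/-- The squared worst-case error of the QMC rule based on the `N`-element point set
`P ⊆ [0,1)^d` in the weighted anchored Sobolev space with weights `γ` (0-indexed, so the
paper's `γ_j` is `γ (j-1)`). -/
noncomputable def sqErr (d N : ℕ) (γ : ℕ → ℝ) (P : Fin N → Fin d → ℝ) : ℝ :=
  (∏ j : Fin d, (1 + γ j.val / 3))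
    - 2 / (N : ℝ) * ∑ n : Fin N, ∏ j : Fin d, (1 + γ j.val / 2 * (1 - P n j ^ 2))
    + 1 / (N : ℝ) ^ 2 *
        ∑ n : Fin N, ∑ h : Fin N, ∏ j : Fin d, (1 + γ j.val * min (1 - P n j) (1 - P h j))

lemma radInv_eq_mod_add_div {p : ℕ} (hp : 1 < p) (n : ℕ) :
    radInv p n = ((n % p : ℕ) + radInv p (n / p)) / p := by
  have hp0 : (0 : ℝ) < p := by exact_mod_cast (by omega : 0 < p)
  have hp1 : (1 : ℝ) < p := by exact_mod_cast hp
  have hs : Summable (fun r : ℕ => ((n / p ^ r % p : ℕ) : ℝ) / (p : ℝ) ^ (r + 1)) := by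
    have hg : Summable (fun r : ℕ => ((1 : ℝ) / p) ^ r) :=
      summable_geometric_of_lt_one (by positivity) (by rw [div_lt_one hp0]; exact hp1)
    refine Summable.of_nonneg_of_le (fun r => by positivity) (fun r => ?_) hg
    rw [div_pow, one_pow, pow_succ, div_le_div_iff₀ (by positivity) (by positivity)]
    have : ((n / p ^ r % p : ℕ) : ℝ) ≤ p := by
      exact_mod_cast (Nat.mod_lt _ (by omega)).le
    nlinarith [pow_pos hp0 r]
  unfold radInv
  rw [hs.tsum_eq_zero_add, add_div, ← tsum_div_const]
  congr 1
  · simp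
  · refine tsum_congr fun r => ?_
    rw [Nat.div_div_eq_div_mul, ← pow_succ', div_div, ← pow_succ]

lemma radInv_mem_Ico {p : ℕ} (hp : 1 < p) (n : ℕ) : radInv p n ∈ Set.Ico (0 : ℝ) 1 := by
  have hp0 : (0 : ℝ) < p := by exact_mod_cast (by omega : 0 < p)
  induction n using Nat.strong_induction_on with
  | _ n ih =>
    rcases Nat.eq_zero_or_pos n with rfl | hn
    · simp [radInv]
    · obtain ⟨h0, h1⟩ := ih (n / p) (Nat.div_lt_self hn hp)
      rw [radInv_eq_mod_add_div hp]
      refine ⟨by positivity, ?_⟩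
      rw [div_lt_one hp0]
      have : ((n % p : ℕ) : ℝ) + 1 ≤ p := by exact_mod_cast Nat.mod_lt n (by omega)
      linarith

lemma rdigit_radInv {p : ℕ} (hp : 1 < p) (n r : ℕ) :
    rdigit p (radInv p n) r = n / p ^ r % p := by
  have hp0 : (0 : ℝ) < p := by exact_mod_cast (by omega : 0 < p)
  unfold rdigit
  rw [Int.floor_toNat]
  induction r generalizing n with
  | zero =>
    have h := radInv_mem_Ico hp (n / p)
    rw [radInv_eq_mod_add_div hp, zero_add, pow_one, div_mul_cancel₀ _ hp0.ne', add_comm,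
      Nat.floor_add_natCast h.1, Nat.floor_eq_zero.2 h.2]
    simp
  | succ r ih =>
    have h := radInv_mem_Ico hp (n / p)
    have e : radInv p n * (p : ℝ) ^ (r + 1 + 1)
        = radInv p (n / p) * (p : ℝ) ^ (r + 1) + ((n % p * p ^ (r + 1) : ℕ) : ℝ) := by
      rw [radInv_eq_mod_add_div hp n, pow_succ (p : ℝ) (r + 1)]
      push_cast
      field_simp
      ring
    rw [e, Nat.floor_add_natCast (mul_nonneg h.1 (by positivity)), pow_succ p r, ← mul_assoc,
      Nat.add_mul_mod_self_right, ih, Nat.div_div_eq_div_mul, mul_comm (p ^ r) p]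

lemma truncVal_radInv {p : ℕ} (hp : 1 < p) (n m : ℕ) :
    truncVal p (radInv p n) m = n % p ^ m := by
  unfold truncVal
  induction m with
  | zero => simp [Nat.mod_one]
  | succ m ih => rw [Finset.sum_range_succ, ih, rdigit_radInv hp, Nat.mod_pow_succ, mul_comm]

/-- On radical inverses of natural numbers the `p`-adic shift is addition. -/
lemma pshift_radInv {p : ℕ} (hp : 1 < p) (n a : ℕ) :
    pshift p (radInv p n) (radInv p a) = radInv p (n + a) := by
  have h : ∀ r, sdigit p (radInv p n) (radInv p a) r = (n + a) / p ^ r % p := fun r => by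
    unfold sdigit
    rw [truncVal_radInv hp, truncVal_radInv hp, ← Nat.add_mod, pow_succ,
      Nat.mod_mul_right_div_self]
  unfold pshift
  simp_rw [h]
  exact Int.fract_eq_self.2 (radInv_mem_Ico hp (n + a))

lemma radInv_add_digit {p : ℕ} (hp : 1 < p) (n d a : ℕ) :
    radInv p (n + (d + p * a)) = (((n + d) % p : ℕ) + radInv p ((n + d) / p + a)) / p := by
  rw [radInv_eq_mod_add_div hp, ← add_assoc, Nat.add_mul_mod_self_left,
    Nat.add_mul_div_left _ _ (by omega)]

lemma sum_range_mul_eq (b c : ℕ) (F : ℕ → ℝ) :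
    ∑ a ∈ range (b * c), F a = ∑ d ∈ range b, ∑ a ∈ range c, F (d + b * a) := by
  rw [Finset.sum_comm]
  induction c with
  | zero => simp
  | succ c ih =>
    rw [Nat.mul_succ, Finset.sum_range_add, ih, Finset.sum_range_succ]
    simp [add_comm]

lemma sum_range_add_of_periodic {p : ℕ} (F : ℕ → ℝ) (hF : ∀ a, F (a + p) = F a) (n : ℕ) :
    ∑ d ∈ range p, F (n + d) = ∑ d ∈ range p, F d := by
  induction n with
  | zero => simp
  | succ n ih =>
    rw [← ih]
    have h1 := Finset.sum_range_succ (fun d => F (n + d)) p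
    have h2 := Finset.sum_range_succ' (fun d => F (n + d)) p
    have h3 : ∑ d ∈ range p, F (n + 1 + d) = ∑ d ∈ range p, F (n + (d + 1)) :=
      Finset.sum_congr rfl fun d _ => by congr 1; ring
    simp only [hF, add_zero] at h1 h2
    linarith

lemma sum_range_mod_eq {p : ℕ} (F : ℕ → ℝ) (n : ℕ) :
    ∑ d ∈ range p, F ((n + d) % p) = ∑ d ∈ range p, F d := by
  rw [sum_range_add_of_periodic (fun a => F (a % p)) (fun a => by simp)]
  exact Finset.sum_congr rfl fun d hd => by rw [Nat.mod_eq_of_lt (Finset.mem_range.1 hd)]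

/-- The mean of `F` over `{0, …, p ^ T - 1}`. -/
noncomputable def powMean (p T : ℕ) (F : ℕ → ℝ) : ℝ :=
  (∑ a ∈ range (p ^ T), F a) / (p : ℝ) ^ T

lemma powMean_succ (p T : ℕ) (F : ℕ → ℝ) :
    powMean p (T + 1) F = (∑ d ∈ range p, powMean p T (fun a => F (d + p * a))) / p := by
  unfold powMean
  rw [pow_succ', sum_range_mul_eq, ← Finset.sum_div, div_div, pow_succ]

lemma powMean_mono (p T : ℕ) {F G : ℕ → ℝ} (h : ∀ a, F a ≤ G a) :
    powMean p T F ≤ powMean p T G := by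
  unfold powMean
  have := Finset.sum_le_sum fun a (_ : a ∈ range (p ^ T)) => h a
  gcongr

lemma powMean_add (p T : ℕ) (F G : ℕ → ℝ) :
    powMean p T (fun a => F a + G a) = powMean p T F + powMean p T G := by
  unfold powMean
  rw [Finset.sum_add_distrib, add_div]

lemma powMean_const_mul (p T : ℕ) (c : ℝ) (F : ℕ → ℝ) :
    powMean p T (fun a => c * F a) = c * powMean p T F := by
  unfold powMean
  rw [← Finset.mul_sum, mul_div_assoc]

lemma powMean_const {p : ℕ} (hp : 0 < p) (T : ℕ) (c : ℝ) : powMean p T (fun _ => c) = c := by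
  have : (p : ℝ) ^ T ≠ 0 := by positivity
  unfold powMean
  simp [this]

lemma sum_range_natCast_eq (p : ℕ) : ∑ d ∈ range p, (d : ℝ) = p * (p - 1) / 2 := by
  induction p with
  | zero => simp
  | succ p ih => rw [Finset.sum_range_succ, ih]; push_cast; ring

lemma sum_range_natCast_sq_eq (p : ℕ) :
    ∑ d ∈ range p, (d : ℝ) ^ 2 = p * (p - 1) * (2 * p - 1) / 6 := by
  induction p with
  | zero => simp
  | succ p ih => rw [Finset.sum_range_succ, ih]; push_cast; ring

lemma abs_powMean_radInv_sub_half_le {p : ℕ} (hp : 1 < p) (T n : ℕ) :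
    |powMean p T (fun a => radInv p (n + a)) - 1 / 2| ≤ 1 / (2 * (p : ℝ) ^ T) := by
  have hp0 : (0 : ℝ) < p := by exact_mod_cast (by omega : 0 < p)
  induction T generalizing n with
  | zero =>
    have h := radInv_mem_Ico hp n
    simp only [powMean, pow_zero, Finset.range_one, Finset.sum_singleton, add_zero, div_one,
      mul_one]
    rw [abs_le]
    constructor <;> linarith [h.1, h.2]
  | succ T ih =>
    have e : powMean p (T + 1) (fun a => radInv p (n + a)) - 1 / 2
        = (∑ d ∈ range p, (powMean p T (fun a => radInv p ((n + d) / p + a)) - 1 / 2)) / p / p := by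
      have h : ∀ d, powMean p T (fun a => radInv p (n + (d + p * a)))
          = 1 / p * (((n + d) % p : ℕ) : ℝ)
            + 1 / p * powMean p T (fun a => radInv p ((n + d) / p + a)) := fun d => by
        rw [← powMean_const_mul, ← powMean_const (p := p) (by omega) T
          (1 / p * (((n + d) % p : ℕ) : ℝ)), ← powMean_add]
        congr 1
        ext a
        rw [radInv_add_digit hp]
        ring
      rw [powMean_succ]
      simp_rw [h]
      rw [Finset.sum_add_distrib, ← Finset.mul_sum, ← Finset.mul_sum,
        sum_range_mod_eq (fun d => (d : ℝ)), sum_range_natCast_eq, Finset.sum_sub_distrib]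
      simp only [Finset.sum_const, Finset.card_range, nsmul_eq_mul]
      field_simp
      ring
    rw [e, abs_div, abs_div, Nat.abs_cast, div_le_iff₀ hp0, div_le_iff₀ hp0]
    refine (Finset.abs_sum_le_sum_abs _ _).trans ?_
    refine (Finset.sum_le_sum fun d _ => ih ((n + d) / p)).trans ?_
    simp only [Finset.sum_const, Finset.card_range, nsmul_eq_mul]
    rw [pow_succ]
    apply le_of_eq
    field_simp

lemma powMean_radInv_sq_le {p : ℕ} (hp : 1 < p) (T n : ℕ) :
    powMean p T (fun a => radInv p (n + a) ^ 2) ≤ 1 / 3 + 1 / (p : ℝ) ^ T := by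
  have hp0 : (0 : ℝ) < p := by exact_mod_cast (by omega : 0 < p)
  have hp1 : (1 : ℝ) < p := by exact_mod_cast hp
  induction T generalizing n with
  | zero =>
    have h := radInv_mem_Ico hp n
    simp only [powMean, pow_zero, Finset.range_one, Finset.sum_singleton, add_zero, div_one]
    nlinarith [h.1, h.2]
  | succ T ih =>
    have h : ∀ d, powMean p T (fun a => radInv p (n + (d + p * a)) ^ 2)
        ≤ (((((n + d) % p : ℕ) : ℝ) ^ 2 + (((n + d) % p : ℕ) : ℝ) * (1 + 1 / (p : ℝ) ^ T))
          + (1 / 3 + 1 / (p : ℝ) ^ T)) / p ^ 2 := fun d => by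
      have e : powMean p T (fun a => radInv p (n + (d + p * a)) ^ 2)
          = (((((n + d) % p : ℕ) : ℝ) ^ 2 + (2 * ((n + d) % p : ℕ) : ℝ) *
              powMean p T (fun a => radInv p ((n + d) / p + a)))
            + powMean p T (fun a => radInv p ((n + d) / p + a) ^ 2)) / p ^ 2 := by
        rw [div_eq_inv_mul, ← powMean_const_mul, ← powMean_const (p := p) (by omega) T
          ((((n + d) % p : ℕ) : ℝ) ^ 2), ← powMean_add, ← powMean_add, ← powMean_const_mul]
        congr 1
        ext a
        rw [radInv_add_digit hp]
        field_simp
        ring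
      rw [e]
      have h1 := (abs_le.1 (abs_powMean_radInv_sub_half_le hp T ((n + d) / p))).2
      have h2 := ih ((n + d) / p)
      have h3 : (0 : ℝ) ≤ ((n + d) % p : ℕ) := Nat.cast_nonneg _
      have h4 : 1 / (2 * (p : ℝ) ^ T) = 1 / (p : ℝ) ^ T / 2 := by field_simp
      refine div_le_div_of_nonneg_right ?_ (by positivity)
      nlinarith
    rw [powMean_succ, div_le_iff₀ hp0]
    refine (Finset.sum_le_sum fun d _ => h d).trans ?_
    rw [← Finset.sum_div, Finset.sum_add_distrib, Finset.sum_add_distrib, ← Finset.sum_mul,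
        sum_range_mod_eq (fun d => (d : ℝ)), sum_range_mod_eq (fun d => (d : ℝ) ^ 2),
        sum_range_natCast_eq, sum_range_natCast_sq_eq]
    simp only [Finset.sum_const, Finset.card_range, nsmul_eq_mul]
    rw [div_le_iff₀ (by positivity), pow_succ]
    set q : ℝ := 1 / (p : ℝ) ^ T with hq
    have hq0 : 0 < q := by positivity
    have e : 1 / ((p : ℝ) ^ T * p) = q / p := by rw [hq]; field_simp
    rw [e]
    have e2 : (1 / 3 + q / p) * p * (p : ℝ) ^ 2 = p ^ 3 / 3 + q * p ^ 2 := by field_simp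
    rw [e2]
    nlinarith [mul_pos hq0 hp0, mul_pos (mul_pos hq0 hp0) (sub_pos.2 hp1)]

/-- The function `d ↦ p ^ (-v) * u * (p - u) / p ^ 2`, where `p ^ v` is the largest power of `p`
dividing `d` and `u` is the residue of `d / p ^ v` modulo `p`, set to zero if `p ^ m ∣ d`. -/
noncomputable def digitGap (p : ℕ) : ℕ → ℤ → ℝ
  | 0, _ => 0
  | m + 1, d =>
    if (p : ℤ) ∣ d then digitGap p m (d / p) / p
    else ((d % p : ℤ) : ℝ) * (p - ((d % p : ℤ) : ℝ)) / p ^ 2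

lemma digitGap_mem_Icc {p : ℕ} (hp : 1 < p) (m : ℕ) (d : ℤ) :
    digitGap p m d ∈ Set.Icc (0 : ℝ) (1 / 4) := by
  have hp0 : (0 : ℝ) < p := by exact_mod_cast (by omega : 0 < p)
  have hp1 : (1 : ℝ) < p := by exact_mod_cast hp
  induction m generalizing d with
  | zero => simp [digitGap]
  | succ m ih =>
    unfold digitGap
    split_ifs
    · obtain ⟨h1, h2⟩ := ih (d / p)
      refine ⟨by positivity, ?_⟩
      rw [div_le_iff₀ hp0]
      linarith
    · have h1 : (0 : ℝ) ≤ ((d % p : ℤ) : ℝ) := by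
        exact_mod_cast Int.emod_nonneg d (by omega)
      have h2 : ((d % p : ℤ) : ℝ) ≤ p := by
        exact_mod_cast (Int.emod_lt_of_pos d (by omega)).le
      refine ⟨div_nonneg (mul_nonneg h1 (by linarith)) (by positivity), ?_⟩
      rw [div_le_iff₀ (by positivity)]
      nlinarith [sq_nonneg ((p : ℝ) - 2 * ((d % p : ℤ) : ℝ))]

lemma sum_abs_add_mod_sub {p u : ℕ} (hu : u < p) :
    ∑ e ∈ range p, |(((e + u) % p : ℕ) : ℝ) - e| = 2 * (u * (p - u)) := by
  obtain ⟨k, rfl⟩ := Nat.exists_eq_add_of_lt hu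
  have e : u + k + 1 = (k + 1) + u := by ring
  rw [e, Finset.sum_range_add]
  have h1 : ∑ e ∈ range (k + 1), |(((e + u) % (k + 1 + u) : ℕ) : ℝ) - e|
      = ∑ _e ∈ range (k + 1), (u : ℝ) := Finset.sum_congr rfl fun e he => by
    rw [Nat.mod_eq_of_lt (by have := Finset.mem_range.1 he; omega)]
    push_cast
    rw [add_sub_cancel_left, abs_of_nonneg (Nat.cast_nonneg _)]
  have h2 : ∑ e ∈ range u, |(((k + 1 + e + u) % (k + 1 + u) : ℕ) : ℝ) - ((k + 1 + e : ℕ) : ℝ)|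
      = ∑ _e ∈ range u, ((k : ℝ) + 1) := Finset.sum_congr rfl fun e he => by
    have : k + 1 + e + u = e + (k + 1 + u) := by ring
    rw [this, Nat.add_mod_right, Nat.mod_eq_of_lt (by have := Finset.mem_range.1 he; omega)]
    push_cast
    rw [abs_sub_comm, add_sub_cancel_right, abs_of_nonneg (by positivity)]
  rw [h1, h2]
  simp only [Finset.sum_const, Finset.card_range, nsmul_eq_mul]
  push_cast
  ring

lemma sum_abs_mod_sub_mod {p : ℕ} (hp : 0 < p) (n h : ℕ) :
    ∑ d ∈ range p, |(((n + d) % p : ℕ) : ℝ) - (((h + d) % p : ℕ) : ℝ)|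
      = 2 * (((((n : ℤ) - h) % p : ℤ) : ℝ) * (p - ((((n : ℤ) - h) % p : ℤ) : ℝ))) := by
  have hp' : (p : ℤ) ≠ 0 := by omega
  obtain ⟨u, hu⟩ := Int.eq_ofNat_of_zero_le (Int.emod_nonneg ((n : ℤ) - h) hp')
  have hup : u < p := by
    have := Int.emod_lt_of_pos ((n : ℤ) - h) (by omega : (0 : ℤ) < p)
    omega
  rw [hu, Int.cast_natCast, ← sum_abs_add_mod_sub hup,
    ← sum_range_mod_eq (fun e => |(((e + u) % p : ℕ) : ℝ) - e|) h]
  refine Finset.sum_congr rfl fun d _ => ?_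
  have : (n + d) % p = ((h + d) % p + u) % p := by
    zify
    rw [Int.emod_add_emod, ← hu, Int.add_emod_emod]
    ring_nf
  rw [this]

lemma mul_sub_le_abs_add_sub (a b : ℝ) : ∃ s : ℝ, |s| = 1 ∧ ∀ x y : ℝ,
    |a - b| + s * (x - y) ≤ |(a + x) - (b + y)| := by
  rcases le_total b a with h | h
  · refine ⟨1, by simp, fun x y => ?_⟩
    rw [abs_of_nonneg (sub_nonneg.2 h)]
    exact le_trans (by linarith) (le_abs_self _)
  · refine ⟨-1, by simp, fun x y => ?_⟩
    rw [abs_of_nonpos (sub_nonpos.2 h)]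
    exact le_trans (by linarith) (neg_le_abs _)

lemma two_mul_digitGap_sub_le_powMean {p : ℕ} (hp : 1 < p) (m T : ℕ) (hm : m ≤ T) (n h : ℕ) :
    2 * digitGap p m ((n : ℤ) - h) - 2 / (p : ℝ) ^ T
      ≤ powMean p T (fun a => |radInv p (n + a) - radInv p (h + a)|) := by
  have hp0 : (0 : ℝ) < p := by exact_mod_cast (by omega : 0 < p)
  induction m generalizing T n h with
  | zero =>
    have h1 : (0 : ℝ) ≤ powMean p T (fun a => |radInv p (n + a) - radInv p (h + a)|) :=
      div_nonneg (Finset.sum_nonneg fun _ _ => abs_nonneg _) (by positivity)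
    have h2 : (0 : ℝ) ≤ 2 / (p : ℝ) ^ T := by positivity
    simp only [digitGap]
    linarith
  | succ m ih =>
    obtain ⟨T, rfl⟩ : ∃ T', T = T' + 1 := ⟨T - 1, by omega⟩
    rw [powMean_succ]
    simp_rw [radInv_add_digit hp]
    rw [le_div_iff₀ hp0]
    unfold digitGap
    split_ifs with hd
    · have key : ∀ d, (2 * digitGap p m (((n : ℤ) - h) / p) - 2 / (p : ℝ) ^ T) / p
          ≤ powMean p T (fun a => |(((n + d) % p : ℕ) + radInv p ((n + d) / p + a)) / p
            - (((h + d) % p : ℕ) + radInv p ((h + d) / p + a)) / p|) := fun d => by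
        have h1 : (n + d) % p = (h + d) % p := by
          have : ((n + d : ℕ) : ℤ) % p = ((h + d : ℕ) : ℤ) % p := by
            refine Int.emod_eq_emod_iff_emod_sub_eq_zero.2 (Int.emod_eq_zero_of_dvd ?_)
            push_cast
            rwa [add_sub_add_right_eq_sub]
          exact_mod_cast this
        have h2 : ((n : ℤ) - h) / p = (((n + d) / p : ℕ) : ℤ) - (((h + d) / p : ℕ) : ℤ) := by
          have a1 := Nat.mod_add_div (n + d) p
          have a2 := Nat.mod_add_div (h + d) p
          apply Int.ediv_eq_of_eq_mul_right (by omega)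
          have a3 : (((n + d) % p : ℕ) : ℤ) + p * ((n + d) / p : ℕ) = n + d := by
            exact_mod_cast a1
          have a4 : (((h + d) % p : ℕ) : ℤ) + p * ((h + d) / p : ℕ) = h + d := by
            exact_mod_cast a2
          rw [h1] at a3
          linear_combination a4 - a3
        have h3 := ih T (by omega) ((n + d) / p) ((h + d) / p)
        rw [← h2] at h3
        have e : powMean p T (fun a => |(((n + d) % p : ℕ) + radInv p ((n + d) / p + a)) / p
            - (((h + d) % p : ℕ) + radInv p ((h + d) / p + a)) / p|)
            = 1 / p * powMean p T (fun a => |radInv p ((n + d) / p + a)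
              - radInv p ((h + d) / p + a)|) := by
          rw [← powMean_const_mul]
          congr 1
          ext a
          rw [h1, ← sub_div, abs_div, Nat.abs_cast, add_sub_add_left_eq_sub]
          ring
        rw [e, div_eq_inv_mul, one_div]
        gcongr
      refine le_trans (le_of_eq ?_) (Finset.sum_le_sum fun d _ => key d)
      simp only [Finset.sum_const, Finset.card_range, nsmul_eq_mul]
      rw [pow_succ]
      field_simp
    · have key : ∀ d, (|(((n + d) % p : ℕ) : ℝ) - (((h + d) % p : ℕ) : ℝ)| - 1 / (p : ℝ) ^ T) / p
          ≤ powMean p T (fun a => |(((n + d) % p : ℕ) + radInv p ((n + d) / p + a)) / p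
            - (((h + d) % p : ℕ) + radInv p ((h + d) / p + a)) / p|) := fun d => by
        obtain ⟨s, hs, hs'⟩ := mul_sub_le_abs_add_sub (((n + d) % p : ℕ) : ℝ)
          (((h + d) % p : ℕ) : ℝ)
        refine le_trans ?_ (powMean_mono p T (F := fun a =>
          1 / p * |(((n + d) % p : ℕ) : ℝ) - (((h + d) % p : ℕ) : ℝ)|
          + (s / p * radInv p ((n + d) / p + a) + -s / p * radInv p ((h + d) / p + a)))
            fun a => ?_)
        · rw [powMean_add, powMean_add, powMean_const (by omega), powMean_const_mul,
            powMean_const_mul]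
          have b1 := abs_powMean_radInv_sub_half_le hp T ((n + d) / p)
          have b2 := abs_powMean_radInv_sub_half_le hp T ((h + d) / p)
          set M1 := powMean p T (fun a => radInv p ((n + d) / p + a))
          set M2 := powMean p T (fun a => radInv p ((h + d) / p + a))
          have b3 : |s * (M1 - M2)| ≤ 1 / (p : ℝ) ^ T := by
            rw [abs_mul, hs, one_mul]
            calc |M1 - M2| = |(M1 - 1 / 2) - (M2 - 1 / 2)| := by ring_nf
              _ ≤ |M1 - 1 / 2| + |M2 - 1 / 2| := abs_sub _ _
              _ ≤ 1 / (2 * (p : ℝ) ^ T) + 1 / (2 * (p : ℝ) ^ T) := add_le_add b1 b2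
              _ = 1 / (p : ℝ) ^ T := by field_simp; norm_num
          have b4 := (abs_le.1 b3).1
          rw [div_le_iff₀ hp0]
          have : (1 / (p : ℝ) * |(((n + d) % p : ℕ) : ℝ) - (((h + d) % p : ℕ) : ℝ)|
            + (s / p * M1 + -s / p * M2)) * p
            = |(((n + d) % p : ℕ) : ℝ) - (((h + d) % p : ℕ) : ℝ)| + s * (M1 - M2) := by
            field_simp
            ring
          rw [this]
          linarith
        · have := hs' (radInv p ((n + d) / p + a)) (radInv p ((h + d) / p + a))
          rw [← sub_div, abs_div, Nat.abs_cast, le_div_iff₀ hp0]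
          refine le_trans (le_of_eq ?_) this
          field_simp
          ring
      refine le_trans ?_ (Finset.sum_le_sum fun d _ => key d)
      rw [← Finset.sum_div, Finset.sum_sub_distrib, sum_abs_mod_sub_mod (by omega)]
      simp only [Finset.sum_const, Finset.card_range, nsmul_eq_mul]
      have hpT : (0 : ℝ) < (p : ℝ) ^ T := by positivity
      rw [pow_succ (p : ℝ) T, le_div_iff₀ hp0, sub_mul, sub_mul]
      have e1 : ∀ z : ℝ, 2 * (z / (p : ℝ) ^ 2) * p * p = 2 * z := fun z => by field_simp
      have e2 : 2 / ((p : ℝ) ^ T * p) * p * p = 2 * (p * (1 / p ^ T)) := by field_simp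
      rw [e1, e2]
      have : 0 ≤ (p : ℝ) * (1 / p ^ T) := by positivity
      linarith

lemma powMean_min_le {p : ℕ} (hp : 1 < p) (m T : ℕ) (hm : m ≤ T) (n h : ℕ) :
    powMean p T (fun a => min (1 - radInv p (n + a)) (1 - radInv p (h + a)))
      ≤ 1 / 2 - digitGap p m ((n : ℤ) - h) + 2 / (p : ℝ) ^ T := by
  have hp0 : (0 : ℝ) < p := by exact_mod_cast (by omega : 0 < p)
  have e : powMean p T (fun a => min (1 - radInv p (n + a)) (1 - radInv p (h + a)))
      = 1 + ((-1 / 2) * powMean p T (fun a => radInv p (n + a))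
        + ((-1 / 2) * powMean p T (fun a => radInv p (h + a))
        + (-1 / 2) * powMean p T (fun a => |radInv p (n + a) - radInv p (h + a)|))) := by
    rw [← powMean_const_mul, ← powMean_const_mul, ← powMean_const_mul,
      ← powMean_add, ← powMean_add]
    refine Eq.trans ?_ (congrArg₂ (· + ·) (powMean_const (p := p) (by omega) T 1) rfl)
    rw [← powMean_add]
    congr 1
    ext a
    rcases le_total (radInv p (n + a)) (radInv p (h + a)) with hle | hle
    · rw [min_eq_right (by linarith), abs_of_nonpos (by linarith)]
      ring
    · rw [min_eq_left (by linarith), abs_of_nonneg (by linarith)]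
      ring
  have b1 := (abs_le.1 (abs_powMean_radInv_sub_half_le hp T n)).1
  have b2 := (abs_le.1 (abs_powMean_radInv_sub_half_le hp T h)).1
  have b3 := two_mul_digitGap_sub_le_powMean hp m T hm n h
  have e1 : 1 / (2 * (p : ℝ) ^ T) = 1 / (p : ℝ) ^ T / 2 := by field_simp
  have e2 : 2 / (p : ℝ) ^ T = 2 * (1 / (p : ℝ) ^ T) := by ring
  have e3 : 0 ≤ 1 / (p : ℝ) ^ T := by positivity
  rw [e]
  rw [e1] at b1 b2
  rw [e2] at b3 ⊢
  linarith

lemma sum_piFinset_prod_eq_powMean {s : ℕ} (p : Fin s → ℕ) (hp : ∀ j, 0 < p j) (T : ℕ)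
    (F : Fin s → ℕ → ℝ) :
    ∑ a ∈ Fintype.piFinset (fun j => range (p j ^ T)), ∏ j, F j (a j)
      = (∏ j, (p j : ℝ) ^ T) * ∏ j, powMean (p j) T (F j) := by
  rw [← Finset.prod_univ_sum, ← Finset.prod_mul_distrib]
  refine Finset.prod_congr rfl fun j _ => ?_
  have : (p j : ℝ) ^ T ≠ 0 := by have := hp j; positivity
  unfold powMean
  field_simp

lemma sum_sqErr_shift {s N : ℕ} (p : Fin s → ℕ) (hp : ∀ j, 1 < p j) (γ : ℕ → ℝ) (T : ℕ) :
    ∑ a ∈ Fintype.piFinset (fun j => range (p j ^ T)),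
      sqErr s N γ (fun n j => pshift (p j) (radInv (p j) n.val) (radInv (p j) (a j)))
    = (∏ j, (p j : ℝ) ^ T) * ((∏ j : Fin s, (1 + γ j.val / 3))
      - 2 / (N : ℝ) * ∑ n : Fin N, ∏ j : Fin s,
          powMean (p j) T (fun a => 1 + γ j.val / 2 * (1 - radInv (p j) (n + a) ^ 2))
      + 1 / (N : ℝ) ^ 2 * ∑ n : Fin N, ∑ h : Fin N, ∏ j : Fin s,
          powMean (p j) T (fun a => 1 + γ j.val *
            min (1 - radInv (p j) (n + a)) (1 - radInv (p j) (h + a)))) := by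
  have hp' : ∀ j, 0 < p j := fun j => (Nat.zero_lt_one.trans (hp j))
  simp only [sqErr, pshift_radInv (hp _)]
  rw [Finset.sum_add_distrib, Finset.sum_sub_distrib, ← Finset.mul_sum, ← Finset.mul_sum,
    mul_add, mul_sub, mul_left_comm _ (2 / (N : ℝ)), mul_left_comm _ (1 / (N : ℝ) ^ 2)]
  congr 1
  · congr 1
    · simp [Fintype.card_piFinset]
    · congr 1
      rw [Finset.sum_comm, Finset.mul_sum univ]
      exact Finset.sum_congr rfl fun n _ => sum_piFinset_prod_eq_powMean p hp' T
        (fun j a => 1 + γ j.val / 2 * (1 - radInv (p j) (n + a) ^ 2))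
  · congr 1
    rw [Finset.sum_comm, Finset.mul_sum univ]
    refine Finset.sum_congr rfl fun n _ => ?_
    rw [Finset.sum_comm, Finset.mul_sum univ]
    exact Finset.sum_congr rfl fun h _ => sum_piFinset_prod_eq_powMean p hp' T
      (fun j a => 1 + γ j.val * min (1 - radInv (p j) (n + a)) (1 - radInv (p j) (h + a)))

lemma exists_shift_sqErr_lt {s N : ℕ} (p : Fin s → ℕ) (hp : ∀ j, 1 < p j) (γ : ℕ → ℝ)
    (hγ0 : ∀ j, 0 ≤ γ j) (hγ1 : ∀ j, γ j ≤ 1) (m : Fin s → ℕ) (B : ℝ)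
    (hB : (∏ j : Fin s, (1 + γ j.val / 3)) - 2 / (N : ℝ) * ∑ _n : Fin N, ∏ j : Fin s,
          (1 + γ j.val / 3)
      + 1 / (N : ℝ) ^ 2 * ∑ n : Fin N, ∑ h : Fin N, ∏ j : Fin s,
          (1 + γ j.val * (1 / 2 - digitGap (p j) (m j) ((n.val : ℤ) - h.val))) < B) :
    ∃ σ : Fin s → ℝ, (∀ j, σ j ∈ Set.Ico (0 : ℝ) 1) ∧
      sqErr s N γ (fun n j => pshift (p j) (radInv (p j) n.val) (σ j)) < B := by
  set V : ℝ → ℝ := fun ε => (∏ j : Fin s, (1 + γ j.val / 3)) - 2 / (N : ℝ) * ∑ _n : Fin N,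
        ∏ j : Fin s, (1 + γ j.val / 2 * (2 / 3 - ε))
      + 1 / (N : ℝ) ^ 2 * ∑ n : Fin N, ∑ h : Fin N, ∏ j : Fin s,
        (1 + γ j.val * (1 / 2 - digitGap (p j) (m j) ((n.val : ℤ) - h.val) + 2 * ε)) with hV
  have hV0 : V 0 < B := by
    refine lt_of_eq_of_lt ?_ hB
    simp only [hV, mul_zero, add_zero, sub_zero]
    have : ∀ x : ℝ, x / 2 * (2 / 3) = x / 3 := fun x => by ring
    simp_rw [this]
  have hcont : Continuous V := by fun_prop
  have hlim : Filter.Tendsto (fun T : ℕ => V ((1 / 2 : ℝ) ^ T)) Filter.atTop (nhds (V 0)) :=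
    (hcont.tendsto 0).comp
      (tendsto_pow_atTop_nhds_zero_of_lt_one (by norm_num) (by norm_num))
  obtain ⟨T, hTV, hTm⟩ := ((hlim.eventually_lt_const hV0).and
    (Filter.eventually_ge_atTop (∑ j, m j))).exists
  have hTm' : ∀ j, m j ≤ T := fun j =>
    (Finset.single_le_sum (fun _ _ => Nat.zero_le _) (Finset.mem_univ j)).trans hTm
  have hε : ∀ j, 1 / (p j : ℝ) ^ T ≤ (1 / 2 : ℝ) ^ T := fun j => by
    rw [one_div_pow]
    have : (2 : ℝ) ≤ p j := by exact_mod_cast hp j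
    gcongr
  have hε1 : (1 / 2 : ℝ) ^ T ≤ 1 := pow_le_one₀ (by norm_num) (by norm_num)
  set ε : ℝ := (1 / 2 : ℝ) ^ T
  have hW : (0 : ℝ) < ∏ j, (p j : ℝ) ^ T := Finset.prod_pos fun j _ => by
    have := hp j
    positivity
  have hlt : ∑ a ∈ Fintype.piFinset (fun j => range (p j ^ T)),
      sqErr s N γ (fun n j => pshift (p j) (radInv (p j) n.val) (radInv (p j) (a j)))
      < ∑ _a ∈ Fintype.piFinset (fun j => range (p j ^ T)), B := by
    rw [sum_sqErr_shift p hp]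
    have e : ∑ _a ∈ Fintype.piFinset (fun j => range (p j ^ T)), B
        = (∏ j, (p j : ℝ) ^ T) * B := by simp [Fintype.card_piFinset]
    rw [e]
    refine mul_lt_mul_of_pos_left (lt_of_le_of_lt ?_ hTV) hW
    simp only [hV]
    have h1 : ∀ n : Fin N, ∏ j : Fin s, (1 + γ j.val / 2 * (2 / 3 - ε)) ≤ ∏ j : Fin s,
        powMean (p j) T (fun a => 1 + γ j.val / 2 * (1 - radInv (p j) (n + a) ^ 2)) := fun n => by
      refine Finset.prod_le_prod (fun j _ => ?_) fun j _ => ?_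
      · nlinarith [hγ0 j, hγ1 j]
      · have e : powMean (p j) T (fun a => 1 + γ j.val / 2 * (1 - radInv (p j) (n + a) ^ 2))
            = (1 + γ j.val / 2)
              + (-(γ j.val / 2)) * powMean (p j) T (fun a => radInv (p j) (n + a) ^ 2) := by
          rw [← powMean_const_mul]
          refine Eq.trans ?_ (congrArg₂ (· + ·)
            (powMean_const (p := p j) (by have := hp j; omega) T _) rfl)
          rw [← powMean_add]
          congr 1
          ext a
          ring
        rw [e]
        have := powMean_radInv_sq_le (hp j) T n
        nlinarith [hγ0 j, hε j]
    have h2 : ∀ n h : Fin N, ∏ j : Fin s, powMean (p j) T (fun a => 1 + γ j.val *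
            min (1 - radInv (p j) (n + a)) (1 - radInv (p j) (h + a)))
        ≤ ∏ j : Fin s,
          (1 + γ j.val * (1 / 2 - digitGap (p j) (m j) ((n.val : ℤ) - h.val) + 2 * ε)) :=
      fun n h => by
      refine Finset.prod_le_prod (fun j _ => ?_) fun j _ => ?_
      · refine div_nonneg (Finset.sum_nonneg fun a _ => ?_) (by positivity)
        have h1 := radInv_mem_Ico (hp j) (n + a)
        have h2 := radInv_mem_Ico (hp j) (h + a)
        have : 0 ≤ min (1 - radInv (p j) (n + a)) (1 - radInv (p j) (h + a)) :=
          le_min (by linarith [h1.2]) (by linarith [h2.2])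
        have := hγ0 j
        positivity
      · rw [powMean_add, powMean_const (by have := hp j; omega), powMean_const_mul]
        have := powMean_min_le (hp j) (m j) T (hTm' j) n h
        have e2 : 2 / (p j : ℝ) ^ T = 2 * (1 / (p j : ℝ) ^ T) := by ring
        have := hγ0 j
        have := hε j
        gcongr
        linarith
    exact add_le_add
      (sub_le_sub_left (mul_le_mul_of_nonneg_left (Finset.sum_le_sum fun n _ => h1 n)
        (by positivity)) _)
      (mul_le_mul_of_nonneg_left (Finset.sum_le_sum fun n _ => Finset.sum_le_sum fun h _ => h2 n h)
        (by positivity))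
  obtain ⟨a, -, ha⟩ := Finset.exists_lt_of_sum_lt hlt
  exact ⟨fun j => radInv (p j) (a j), fun j => radInv_mem_Ico (hp j) _, ha⟩

/-- The additive character `x ↦ exp (2 π i x)` of the real line. -/
noncomputable def unitExp (x : ℝ) : ℂ := Complex.exp (2 * Real.pi * Complex.I * x)

lemma unitExp_add (x y : ℝ) : unitExp (x + y) = unitExp x * unitExp y := by
  simp only [unitExp]
  rw [← Complex.exp_add]
  push_cast
  ring_nf

lemma unitExp_zero : unitExp 0 = 1 := by simp [unitExp]

lemma unitExp_natCast_mul (n : ℕ) (x : ℝ) : unitExp (n * x) = unitExp x ^ n := by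
  simp only [unitExp]
  rw [← Complex.exp_nat_mul]
  push_cast
  ring_nf

lemma unitExp_sum {ι : Type*} (s : Finset ι) (f : ι → ℝ) :
    unitExp (∑ i ∈ s, f i) = ∏ i ∈ s, unitExp (f i) := by
  classical
  induction s using Finset.induction_on with
  | empty => simp [unitExp_zero]
  | insert i s hi ih => rw [Finset.sum_insert hi, Finset.prod_insert hi, unitExp_add, ih]

lemma unitExp_eq_one_iff (x : ℝ) : unitExp x = 1 ↔ ∃ n : ℤ, x = n := by
  unfold unitExp
  rw [Complex.exp_eq_one_iff]
  have h : (2 * (Real.pi : ℂ) * Complex.I) ≠ 0 := Complex.two_pi_I_ne_zero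
  refine exists_congr fun n => ⟨fun hn => ?_, fun hn => ?_⟩
  · rw [mul_comm (n : ℂ)] at hn
    exact_mod_cast mul_left_cancel₀ h hn
  · rw [hn]
    push_cast
    ring

lemma unitExp_intCast (n : ℤ) : unitExp n = 1 := (unitExp_eq_one_iff _).2 ⟨n, rfl⟩

lemma conj_unitExp (x : ℝ) : (starRingEnd ℂ) (unitExp x) = unitExp (-x) := by
  unfold unitExp
  rw [← Complex.exp_conj]
  simp [Complex.conj_ofNat]

lemma sum_unitExp_mul_div {M : ℕ} (hM : 0 < M) (d : ℤ) :
    ∑ k ∈ range M, unitExp (k * (d / M)) = if (M : ℤ) ∣ d then (M : ℂ) else 0 := by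
  have hM' : (M : ℝ) ≠ 0 := by positivity
  simp_rw [unitExp_natCast_mul]
  have hiff : unitExp ((d : ℝ) / M) = 1 ↔ (M : ℤ) ∣ d := by
    rw [unitExp_eq_one_iff]
    refine exists_congr fun n => ?_
    rw [div_eq_iff hM']
    constructor
    · intro h
      have : d = n * M := by exact_mod_cast h
      rw [this, mul_comm]
    · rintro rfl
      push_cast
      ring
  split_ifs with h
  · rw [hiff.2 h]
    simp
  · have h1 : unitExp ((d : ℝ) / M) ≠ 1 := fun h' => h (hiff.1 h')
    rw [geom_sum_eq h1, ← unitExp_natCast_mul, mul_div_cancel₀ _ hM', unitExp_intCast]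
    simp

/-- The mean-zero part on the residues modulo `p` of the shift-averaged kernel. -/
noncomputable def residueKernel (p w : ℕ) : ℝ :=
  1 / 6 - w * (p - w) / p ^ 2 - (if w = 0 then 1 / (6 * (p : ℝ)) else 0)

lemma abs_residueKernel_le {p w : ℕ} (hw : w < p) : |residueKernel p w| ≤ 1 / 6 := by
  have hp0 : (0 : ℝ) < p := by exact_mod_cast (by omega : 0 < p)
  have hp1 : (1 : ℝ) ≤ p := by exact_mod_cast (by omega : 1 ≤ p)
  unfold residueKernel
  split_ifs with h
  · subst h
    have h1 : 1 / (6 * (p : ℝ)) ≤ 1 / 6 := by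
      rw [div_le_div_iff₀ (by positivity) (by positivity)]
      linarith
    have h2 : 0 < 1 / (6 * (p : ℝ)) := by positivity
    rw [abs_le]
    simp only [Nat.cast_zero, zero_mul, zero_div, sub_zero]
    constructor <;> linarith
  · have hw' : (w : ℝ) ≤ p := by exact_mod_cast hw.le
    have h1 : 0 ≤ (w : ℝ) * (p - w) / p ^ 2 :=
      div_nonneg (mul_nonneg (Nat.cast_nonneg _) (by linarith)) (by positivity)
    have h2 : (w : ℝ) * (p - w) / p ^ 2 ≤ 1 / 4 := by
      rw [div_le_iff₀ (by positivity)]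
      nlinarith [sq_nonneg ((p : ℝ) - 2 * w)]
    rw [abs_le]
    constructor <;> linarith

lemma sum_mul_sub_mul_pow (P z : ℂ) (n : ℕ) :
    (1 - z) ^ 3 * ∑ w ∈ range n, (w : ℂ) * (P - w) * z ^ w
      = z ^ n * ((1 - z) ^ 2 * n ^ 2 + (-P * (1 - z) ^ 2 + 2 * z * (1 - z)) * n
        + z * (1 + z - P * (1 - z))) - z * (1 + z - P * (1 - z)) := by
  induction n with
  | zero => simp
  | succ n ih =>
    rw [Finset.sum_range_succ, mul_add, ih, pow_succ]
    push_cast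
    ring

lemma sum_residueKernel {p : ℕ} (hp : 0 < p) : ∑ w ∈ range p, residueKernel p w = 0 := by
  have h : ∑ w ∈ range p, (w : ℝ) * (p - w) = p * (p ^ 2 - 1) / 6 := by
    have : ∀ w : ℕ, (w : ℝ) * (p - w) = p * w - (w : ℝ) ^ 2 := fun w => by ring
    simp_rw [this]
    rw [Finset.sum_sub_distrib, ← Finset.mul_sum, sum_range_natCast_eq, sum_range_natCast_sq_eq]
    ring
  unfold residueKernel
  rw [Finset.sum_sub_distrib, Finset.sum_sub_distrib, ← Finset.sum_div _ _ ((p : ℝ) ^ 2), h]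
  have hp0 : (p : ℝ) ≠ 0 := by positivity
  simp [hp]
  field_simp
  ring

lemma exists_residueKernel_dft {p : ℕ} (hp : 0 < p) {z : ℂ} (hz : z ^ p = 1) :
    ∃ r : ℝ, 0 ≤ r ∧ r ≤ 1 / 6 ∧ (z = 1 → r = 0) ∧
      (∑ w ∈ range p, (residueKernel p w : ℂ) * z ^ w) / p = r := by
  have hp0 : (0 : ℝ) < p := by positivity
  have hpc : (p : ℂ) ≠ 0 := by exact_mod_cast hp.ne'
  by_cases h1 : z = 1
  · refine ⟨0, le_rfl, by norm_num, fun _ => rfl, ?_⟩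
    subst h1
    simp only [one_pow, mul_one]
    rw [← Complex.ofReal_sum, sum_residueKernel hp]
    simp
  · have hz1 : ‖z‖ = 1 := Complex.norm_eq_one_of_pow_eq_one hz hp.ne'
    have h1' : 1 - z ≠ 0 := fun h => h1 (by linear_combination -h)
    set D : ℝ := Complex.normSq (1 - z) with hD
    have hD0 : 0 < D := Complex.normSq_pos.2 h1'
    have hD4 : D ≤ 4 := by
      rw [hD, Complex.normSq_eq_norm_sq]
      have : ‖1 - z‖ ≤ 2 := (norm_sub_le _ _).trans (by rw [hz1]; norm_num)
      nlinarith [norm_nonneg (1 - z)]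
    have hDz : (D : ℂ) * z = -(1 - z) ^ 2 := by
      have hzz : z * (starRingEnd ℂ) z = 1 := by
        rw [Complex.mul_conj, Complex.normSq_eq_norm_sq, hz1]
        norm_num
      have : (D : ℂ) = (1 - z) * (1 - (starRingEnd ℂ) z) := by
        rw [hD, ← Complex.mul_conj, map_sub, map_one]
      rw [this]
      linear_combination (z - 1) * hzz
    have hz0 : z ≠ 0 := fun h => by simp [h] at hz1
    set S := ∑ w ∈ range p, (w : ℂ) * (p - w) * z ^ w with hS
    have hS1 : (D : ℂ) * S = -2 * p := by
      have h3 := sum_mul_sub_mul_pow p z p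
      rw [hz] at h3
      apply mul_right_cancel₀ (mul_ne_zero h1' hz0)
      linear_combination (1 - z) * S * hDz - h3
    have hsum : ∑ w ∈ range p, (residueKernel p w : ℂ) * z ^ w
        = -S / p ^ 2 - 1 / (6 * p) := by
      have hg : ∑ w ∈ range p, z ^ w = 0 := by
        rw [geom_sum_eq h1, hz]
        simp
      have : ∀ w, (residueKernel p w : ℂ) * z ^ w = 1 / 6 * z ^ w
          - ((w : ℂ) * (p - w) * z ^ w) / p ^ 2 - (if w = 0 then 1 / (6 * (p : ℂ)) else 0) := by
        intro w
        unfold residueKernel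
        split_ifs with h
        · subst h
          push_cast
          ring
        · push_cast
          ring
      simp_rw [this]
      rw [Finset.sum_sub_distrib, Finset.sum_sub_distrib, ← Finset.mul_sum, hg,
        ← Finset.sum_div, ← hS, Finset.sum_ite_eq']
      simp [hp]
      ring
    have hr : (∑ w ∈ range p, (residueKernel p w : ℂ) * z ^ w) / p
        = (((2 / D - 1 / 6) / p ^ 2 : ℝ) : ℂ) := by
      have hDc : (D : ℂ) ≠ 0 := by exact_mod_cast hD0.ne'
      have hS2 : S = -2 * p / D := by
        rw [eq_div_iff hDc, mul_comm]
        exact hS1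
      rw [hsum, hS2]
      push_cast
      field_simp
    have hrnn : 0 ≤ (2 / D - 1 / 6) / (p : ℝ) ^ 2 := by
      have : 1 / 2 ≤ 2 / D := by
        rw [div_le_div_iff₀ (by norm_num) hD0]
        linarith
      exact div_nonneg (by linarith) (by positivity)
    refine ⟨(2 / D - 1 / 6) / p ^ 2, hrnn, ?_, fun h => absurd h h1, hr⟩
    have hn := congrArg norm hr
    rw [Complex.norm_real, Real.norm_of_nonneg hrnn] at hn
    rw [← hn, norm_div, Complex.norm_natCast, div_le_iff₀ hp0]
    refine (norm_sum_le _ _).trans ?_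
    calc ∑ w ∈ range p, ‖(residueKernel p w : ℂ) * z ^ w‖ ≤ ∑ _w ∈ range p, (1 / 6 : ℝ) :=
          Finset.sum_le_sum fun w hw => by
            rw [norm_mul, norm_pow, hz1, one_pow, mul_one, Complex.norm_real, Real.norm_eq_abs]
            exact abs_residueKernel_le (Finset.mem_range.1 hw)
      _ = 1 / 6 * p := by simp [mul_comm]

/-- The part of the shift-averaged kernel in base `p` carried by the characters of order exactly
`p ^ (t + 1)`. -/
noncomputable def levelKernel (p t : ℕ) (d : ℤ) : ℝ :=
  (∑ w ∈ range p, residueKernel p w * if ((p ^ (t + 1) : ℕ) : ℤ) ∣ d - w * p ^ t then (1 : ℝ) else 0)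
    / p ^ t

lemma exists_levelKernel_fourier {p : ℕ} (hp : 0 < p) (t : ℕ) : ∃ a : ℕ → ℝ,
    (∀ k, 0 ≤ a k) ∧ (∀ k, a k ≤ 1 / (6 * (p : ℝ) ^ (2 * t))) ∧ a 0 = 0 ∧
    ∀ d : ℤ, (levelKernel p t d : ℂ)
      = ∑ k ∈ range (p ^ (t + 1)), (a k : ℂ) * unitExp (k * (d / (p ^ (t + 1) : ℕ))) := by
  have hp0 : (0 : ℝ) < p := by positivity
  have hpc : (p : ℂ) ≠ 0 := by exact_mod_cast hp.ne'
  have hz : ∀ k : ℕ, unitExp (-(k / p)) ^ p = 1 := fun k => by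
    rw [← unitExp_natCast_mul]
    have : (p : ℝ) * -(k / p) = ((-k : ℤ) : ℝ) := by
      push_cast
      field_simp
    rw [this, unitExp_intCast]
  choose r hr0 hr1 hr2 hr using fun k => exists_residueKernel_dft hp (hz k)
  refine ⟨fun k => r k / p ^ (2 * t), fun k => div_nonneg (hr0 k) (by positivity), fun k => ?_,
    ?_, fun d => ?_⟩
  · rw [← div_div]
    exact div_le_div_of_nonneg_right (hr1 k) (by positivity)
  · simp [hr2 0 (by simp [unitExp_zero])]
  · have key : ∀ w : ℕ, ∑ k ∈ range (p ^ (t + 1)), unitExp (-(k / p)) ^ w *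
        unitExp (k * (d / (p ^ (t + 1) : ℕ)))
        = if ((p ^ (t + 1) : ℕ) : ℤ) ∣ d - w * p ^ t then ((p ^ (t + 1) : ℕ) : ℂ) else 0 := by
      intro w
      rw [← sum_unitExp_mul_div (by positivity)]
      refine Finset.sum_congr rfl fun k _ => ?_
      rw [← unitExp_natCast_mul, ← unitExp_add]
      congr 1
      push_cast
      rw [pow_succ]
      field_simp
      ring
    simp_rw [Complex.ofReal_div, ← hr, Complex.ofReal_pow, Complex.ofReal_natCast, Finset.sum_div,
      Finset.sum_mul]
    rw [Finset.sum_comm]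
    unfold levelKernel
    push_cast
    rw [Finset.sum_div]
    refine Finset.sum_congr rfl fun w _ => ?_
    have : ∀ k : ℕ, (residueKernel p w : ℂ) * unitExp (-(k / p)) ^ w / p / p ^ (2 * t) *
        unitExp (k * (d / (p ^ (t + 1))))
        = (residueKernel p w : ℂ) / p / p ^ (2 * t) *
          (unitExp (-(k / p)) ^ w * unitExp (k * (d / (p ^ (t + 1) : ℕ)))) := fun k => by
      push_cast
      ring
    simp_rw [this]
    rw [← Finset.mul_sum, key]
    push_cast
    split_ifs
    · rw [pow_succ, pow_mul']
      field_simp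
      simp
    · simp

lemma levelKernel_zero {p : ℕ} (hp : 0 < p) (d : ℤ) :
    levelKernel p 0 d = residueKernel p (d % p).toNat := by
  have hp' : (p : ℤ) ≠ 0 := by omega
  have h0 := Int.emod_nonneg d hp'
  have h1 := Int.emod_lt_of_pos d (by omega : (0 : ℤ) < p)
  unfold levelKernel
  rw [Finset.sum_eq_single (d % p).toNat]
  · rw [if_pos]
    · simp
    · rw [Int.toNat_of_nonneg h0]
      simpa using Int.dvd_self_sub_emod
  · intro w hw hne
    rw [if_neg, mul_zero]
    intro hdvd
    apply hne
    have hw' := Finset.mem_range.1 hw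
    have : d % p = w := by
      have h2 : d % p = (w : ℤ) % p := by
        refine Int.emod_eq_emod_iff_emod_sub_eq_zero.2 (Int.emod_eq_zero_of_dvd ?_)
        simpa using hdvd
      rw [h2]
      exact Int.emod_eq_of_lt (by omega) (by omega)
    omega
  · intro h
    exact absurd (Finset.mem_range.2 (by omega)) h

lemma levelKernel_succ {p : ℕ} (hp : 0 < p) (t : ℕ) (d : ℤ) :
    levelKernel p (t + 1) d = if (p : ℤ) ∣ d then levelKernel p t (d / p) / p else 0 := by
  have hp' : (p : ℤ) ≠ 0 := by omega
  unfold levelKernel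
  split_ifs with h
  · obtain ⟨d, rfl⟩ := h
    rw [Int.mul_ediv_cancel_left _ hp', div_div, ← pow_succ]
    have : ∀ w : ℕ, ((p ^ (t + 1 + 1) : ℕ) : ℤ) ∣ p * d - w * p ^ (t + 1)
        ↔ ((p ^ (t + 1) : ℕ) : ℤ) ∣ d - w * p ^ t := fun w => by
      have e1 : ((p ^ (t + 1 + 1) : ℕ) : ℤ) = p * ((p ^ (t + 1) : ℕ) : ℤ) := by
        push_cast
        ring
      have e2 : (p : ℤ) * d - w * p ^ (t + 1) = p * (d - w * p ^ t) := by ring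
      rw [e1, e2, mul_dvd_mul_iff_left hp']
    simp_rw [this]
  · rw [Finset.sum_eq_zero, zero_div]
    intro w _
    rw [if_neg, mul_zero]
    intro hdvd
    apply h
    have h1 : (p : ℤ) ∣ ((p ^ (t + 1 + 1) : ℕ) : ℤ) := by
      push_cast
      exact dvd_pow_self _ (by omega)
    have h2 : (p : ℤ) ∣ (w : ℤ) * p ^ (t + 1) := Dvd.dvd.mul_left (dvd_pow_self _ (by omega)) _
    exact (dvd_sub_left h2).1 (h1.trans hdvd)

lemma half_sub_digitGap {p : ℕ} (hp : 0 < p) (m : ℕ) (d : ℤ) :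
    1 / 2 - digitGap p m d = 1 / 3 + ∑ t ∈ range m, levelKernel p t d
      + if ((p ^ m : ℕ) : ℤ) ∣ d then 1 / (6 * (p : ℝ) ^ m) else 0 := by
  have hp' : (p : ℤ) ≠ 0 := by omega
  have hpr : (p : ℝ) ≠ 0 := by positivity
  induction m generalizing d with
  | zero =>
    simp [digitGap]
    norm_num
  | succ m ih =>
    rw [Finset.sum_range_succ', levelKernel_zero hp]
    simp_rw [levelKernel_succ hp]
    unfold digitGap
    by_cases h : (p : ℤ) ∣ d
    · simp only [if_pos h]
      have h0 : d % p = 0 := Int.emod_eq_zero_of_dvd h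
      rw [h0]
      obtain ⟨d, rfl⟩ := h
      rw [Int.mul_ediv_cancel_left _ hp', ← Finset.sum_div]
      have hiff : ((p ^ (m + 1) : ℕ) : ℤ) ∣ p * d ↔ ((p ^ m : ℕ) : ℤ) ∣ d := by
        have e1 : ((p ^ (m + 1) : ℕ) : ℤ) = p * ((p ^ m : ℕ) : ℤ) := by
          push_cast
          ring
        rw [e1, mul_dvd_mul_iff_left hp']
      have e := ih d
      have e' : digitGap p m d = 1 / 2 - (1 / 3 + ∑ t ∈ range m, levelKernel p t d
          + if ((p ^ m : ℕ) : ℤ) ∣ d then 1 / (6 * (p : ℝ) ^ m) else 0) := by linarith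
      rw [e']
      simp only [hiff, residueKernel]
      split_ifs
      · simp
        field_simp
        ring
      · simp at *
      · simp
        field_simp
        ring
      · simp at *
    · simp only [if_neg h]
      have h1 := Int.emod_nonneg d hp'
      have h2 : d % p ≠ 0 := fun h0 => h (Int.dvd_of_emod_eq_zero h0)
      have h3 : ¬ ((p ^ (m + 1) : ℕ) : ℤ) ∣ d := fun hd => h (dvd_trans (by
        push_cast
        exact dvd_pow_self _ (by omega)) hd)
      rw [if_neg h3]
      unfold residueKernel
      rw [if_neg (by omega)]
      have h4 : (((d % p).toNat : ℕ) : ℝ) = ((d % p : ℤ) : ℝ) := by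
        exact_mod_cast congrArg (fun z : ℤ => (z : ℝ)) (Int.toNat_of_nonneg h1)
      rw [h4, Finset.sum_const_zero]
      ring

lemma mul_card_pairs_sub_sq_le {M : ℕ} (hM : 0 < M) (N : ℕ) :
    (M : ℝ) * ∑ n ∈ range N, ∑ h ∈ range N, (if (M : ℤ) ∣ (n : ℤ) - h then (1 : ℝ) else 0)
      - (N : ℝ) ^ 2 ≤ (M : ℝ) ^ 2 := by
  set x : ℕ → ℝ := fun c => ∑ n ∈ range N, if n % M = c then (1 : ℝ) else 0 with hx
  have hind : ∀ n h : ℕ, (if (M : ℤ) ∣ (n : ℤ) - h then (1 : ℝ) else 0)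
      = ∑ c ∈ range M, (if n % M = c then (1 : ℝ) else 0) * (if h % M = c then (1 : ℝ) else 0) := by
    intro n h
    have hn : n % M ∈ range M := Finset.mem_range.2 (Nat.mod_lt _ hM)
    simp_rw [ite_mul, one_mul, zero_mul]
    rw [Finset.sum_ite_eq, if_pos hn]
    refine if_congr ?_ rfl rfl
    rw [eq_comm, ← Nat.modEq_iff_dvd]
    exact eq_comm
  have hP : ∑ n ∈ range N, ∑ h ∈ range N, (if (M : ℤ) ∣ (n : ℤ) - h then (1 : ℝ) else 0)
      = ∑ c ∈ range M, x c ^ 2 := by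
    simp_rw [hind]
    have : ∀ n, ∑ h ∈ range N, ∑ c ∈ range M,
        (if n % M = c then (1 : ℝ) else 0) * (if h % M = c then (1 : ℝ) else 0)
        = ∑ c ∈ range M, (if n % M = c then (1 : ℝ) else 0) * x c := fun n => by
      rw [Finset.sum_comm]
      simp_rw [hx, Finset.mul_sum]
    simp_rw [this]
    rw [Finset.sum_comm]
    refine Finset.sum_congr rfl fun c _ => ?_
    rw [← Finset.sum_mul, sq]
  have hN : ∑ c ∈ range M, x c = N := by
    rw [hx, Finset.sum_comm]
    have : ∀ n, ∑ c ∈ range M, (if n % M = c then (1 : ℝ) else 0) = 1 := fun n => by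
      rw [Finset.sum_ite_eq, if_pos (Finset.mem_range.2 (Nat.mod_lt _ hM))]
    simp [this]
  set q : ℝ := ((N / M : ℕ) : ℝ)
  have hy : ∀ c ∈ range M, 0 ≤ x c - q ∧ x c - q ≤ 1 := fun c hc => by
    have hc' := Nat.mod_eq_of_lt (Finset.mem_range.1 hc)
    have h1 : x c = ((N.count (· ≡ c [MOD M]) : ℕ) : ℝ) := by
      rw [Nat.count_eq_card_filter_range, hx]
      simp only [Nat.ModEq, hc', Finset.sum_boole]
    rw [h1, Nat.count_modEq_card N hM c]
    push_cast
    split_ifs <;> simp [q]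
  rw [hP]
  have h1 : ∑ c ∈ range M, x c ^ 2
      = ∑ c ∈ range M, (x c - q) ^ 2 + 2 * q * N - M * q ^ 2 := by
    rw [← hN, Finset.mul_sum]
    have : (M : ℝ) * q ^ 2 = ∑ c ∈ range M, q ^ 2 := by simp
    rw [this, ← Finset.sum_add_distrib, ← Finset.sum_sub_distrib]
    exact Finset.sum_congr rfl fun c _ => by ring
  have h2 : ∑ c ∈ range M, (x c - q) ^ 2 ≤ M := by
    refine (Finset.sum_le_sum fun c hc => pow_le_one₀ (n := 2) (hy c hc).1 (hy c hc).2).trans ?_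
    simp
  have hM0 : (0 : ℝ) ≤ M := Nat.cast_nonneg _
  rw [h1]
  nlinarith [sq_nonneg ((N : ℝ) - M * q)]

lemma sum_prod_fourier {s : ℕ} (M : Fin s → ℕ) (φ : Fin s → ℤ → ℝ) (a : Fin s → ℕ → ℝ)
    (hφ : ∀ j d, (φ j d : ℂ) = ∑ k ∈ range (M j), (a j k : ℂ) * unitExp (k * (d / M j))) (N : ℕ) :
    ∑ n ∈ range N, ∑ h ∈ range N, ∏ j, φ j ((n : ℤ) - h)
      = ∑ k ∈ Fintype.piFinset (fun j => range (M j)), (∏ j, a j (k j)) *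
        Complex.normSq (∑ n ∈ range N, unitExp (n * ∑ j, (k j : ℝ) / M j)) := by
  apply Complex.ofReal_injective
  have hprod : ∀ d : ℤ, ∏ j, (φ j d : ℂ) = ∑ k ∈ Fintype.piFinset (fun j => range (M j)),
      (∏ j, (a j (k j) : ℂ)) * unitExp (d * ∑ j, (k j : ℝ) / M j) := fun d => by
    simp_rw [hφ]
    rw [Finset.prod_univ_sum]
    refine Finset.sum_congr rfl fun k _ => ?_
    rw [Finset.prod_mul_distrib, Finset.mul_sum, unitExp_sum]
    congr 1
    refine Finset.prod_congr rfl fun j _ => ?_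
    congr 1
    ring
  push_cast
  simp_rw [hprod]
  have hsq : ∀ θ : ℝ, (Complex.normSq (∑ n ∈ range N, unitExp (n * θ)) : ℂ)
      = ∑ n ∈ range N, ∑ h ∈ range N, unitExp ((((n : ℤ) - h : ℤ) : ℝ) * θ) := fun θ => by
    rw [← Complex.mul_conj, map_sum, Finset.sum_mul_sum]
    refine Finset.sum_congr rfl fun n _ => Finset.sum_congr rfl fun h _ => ?_
    rw [conj_unitExp, ← unitExp_add]
    congr 1
    push_cast
    ring
  simp_rw [hsq, Finset.mul_sum]
  refine Eq.trans ?_ Finset.sum_comm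
  refine Finset.sum_congr rfl fun n _ => ?_
  exact Finset.sum_comm

lemma sum_prod_fourier_le {s : ℕ} (M : Fin s → ℕ) (hM : ∀ j, 0 < M j)
    (hcop : Pairwise (Function.onFun Nat.Coprime M)) (φ : Fin s → ℤ → ℝ) (a : Fin s → ℕ → ℝ)
    (hφ : ∀ j d, (φ j d : ℂ) = ∑ k ∈ range (M j), (a j k : ℂ) * unitExp (k * (d / M j)))
    (B : Fin s → ℝ) (ha0 : ∀ j k, 0 ≤ a j k) (haB : ∀ j k, a j k ≤ B j) (j₀ : Fin s)
    (hj₀ : a j₀ 0 = 0) (N : ℕ) :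
    ∑ n ∈ range N, ∑ h ∈ range N, ∏ j, φ j ((n : ℤ) - h)
      ≤ (∏ j, B j) * (∏ j, (M j : ℝ)) ^ 2 := by
  have hB : 0 ≤ ∏ j, B j := Finset.prod_nonneg fun j _ => (ha0 j 0).trans (haB j 0)
  rw [sum_prod_fourier M φ a hφ]
  have hzero : (fun _ => 0) ∈ Fintype.piFinset (fun j => range (M j)) :=
    Fintype.mem_piFinset.2 fun j => Finset.mem_range.2 (hM j)
  have hterm : ∀ k ∈ Fintype.piFinset (fun j => range (M j)), (∏ j, a j (k j)) *
        Complex.normSq (∑ n ∈ range N, unitExp (n * ∑ j, (k j : ℝ) / M j))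
      ≤ (∏ j, B j) * (Complex.normSq (∑ n ∈ range N, unitExp (n * ∑ j, (k j : ℝ) / M j))
        - if k = (fun _ => 0) then (N : ℝ) ^ 2 else 0) := by
    intro k _
    split_ifs with hk
    · subst hk
      rw [Finset.prod_eq_zero (Finset.mem_univ j₀) hj₀]
      simp [unitExp_zero, sq]
    · rw [sub_zero]
      exact mul_le_mul_of_nonneg_right
        (Finset.prod_le_prod (fun j _ => ha0 j _) fun j _ => haB j _) (Complex.normSq_nonneg _)
  refine (Finset.sum_le_sum hterm).trans ?_
  rw [← Finset.mul_sum, Finset.sum_sub_distrib, Finset.sum_ite_eq', if_pos hzero]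
  refine mul_le_mul_of_nonneg_left ?_ hB
  have h1 := sum_prod_fourier M (fun j d => if (M j : ℤ) ∣ d then (M j : ℝ) else 0)
    (fun _ _ => 1) (fun j d => by
      have := sum_unitExp_mul_div (hM j) d
      push_cast
      simp only [one_mul]
      rw [this]
      split_ifs <;> simp) N
  simp only [Finset.prod_const_one, one_mul] at h1
  rw [← h1]
  have h2 : ∀ d : ℤ, ∏ j, (if (M j : ℤ) ∣ d then (M j : ℝ) else 0)
      = ((∏ j, M j : ℕ) : ℝ) * if ((∏ j, M j : ℕ) : ℤ) ∣ d then 1 else 0 := fun d => by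
    rw [Finset.prod_ite_zero, mul_ite, mul_one, mul_zero]
    push_cast
    by_cases h : ∀ j ∈ univ, (M j : ℤ) ∣ d
    · rw [if_pos h, if_pos (Finset.prod_dvd_of_coprime
        (fun i _ j _ hij => Nat.isCoprime_iff_coprime.2 (hcop hij)) h)]
    · rw [if_neg h, if_neg fun h' => h fun j hj => (Finset.dvd_prod_of_mem _ hj).trans h']
  simp_rw [h2, ← Finset.mul_sum]
  have h3 := mul_card_pairs_sub_sq_le (Finset.prod_pos fun j _ => hM j) N (M := ∏ j, M j)
  refine h3.trans (le_of_eq ?_)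
  push_cast
  rfl

lemma one_add_sum_le_prod_one_add {ι : Type*} (S : Finset ι) (f : ι → ℝ) (hf : ∀ i, 0 ≤ f i) :
    1 + ∑ i ∈ S, f i ≤ ∏ i ∈ S, (1 + f i) := by
  classical
  induction S using Finset.induction_on with
  | empty => simp
  | insert i S hi ih =>
    rw [Finset.prod_insert hi, Finset.sum_insert hi]
    have hS : 0 ≤ ∑ i ∈ S, f i := Finset.sum_nonneg fun i _ => hf i
    nlinarith [hf i, mul_nonneg (hf i) hS]

lemma prod_sub_prod_le {ι : Type*} (S : Finset ι) (F G A : ι → ℝ) (hG : ∀ i, 0 ≤ G i)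
    (hGF : ∀ i, G i ≤ F i) (hFA : ∀ i, F i ≤ A i) (hA : ∀ i, 1 ≤ A i) :
    ∏ i ∈ S, F i - ∏ i ∈ S, G i ≤ (∏ i ∈ S, A i) * ∑ i ∈ S, (F i - G i) := by
  classical
  induction S using Finset.induction_on with
  | empty => simp
  | insert i S hi ih =>
    rw [Finset.prod_insert hi, Finset.prod_insert hi, Finset.prod_insert hi, Finset.sum_insert hi]
    have hA1 : 1 ≤ ∏ i ∈ S, A i := Finset.one_le_prod fun i _ => hA i
    have hFP : ∏ i ∈ S, F i ≤ ∏ i ∈ S, A i :=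
      Finset.prod_le_prod (fun i _ => (hG i).trans (hGF i)) fun i _ => hFA i
    have hsum : 0 ≤ ∑ i ∈ S, (F i - G i) := Finset.sum_nonneg fun i _ => sub_nonneg.2 (hGF i)
    have hd := sub_nonneg.2 (hGF i)
    have h1 : (F i - G i) * ∏ i ∈ S, F i ≤ A i * (∏ i ∈ S, A i) * (F i - G i) := by
      have : ∏ i ∈ S, F i ≤ A i * ∏ i ∈ S, A i := by nlinarith [hA i]
      nlinarith
    have h2 : G i * (∏ i ∈ S, F i - ∏ i ∈ S, G i)
        ≤ A i * ((∏ i ∈ S, A i) * ∑ i ∈ S, (F i - G i)) :=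
      (mul_le_mul_of_nonneg_left ih (hG i)).trans
        (mul_le_mul_of_nonneg_right ((hGF i).trans (hFA i)) (by positivity))
    linarith

lemma sum_dvd_sub_le {p N m : ℕ} (hp : 0 < p) (h : N ≤ p ^ m ∨ m = 0 ∧ N ^ 2 ≤ p) :
    ∑ n ∈ range N, ∑ h ∈ range N,
      (if ((p ^ m : ℕ) : ℤ) ∣ (n : ℤ) - h then 1 / (6 * (p : ℝ) ^ m) else 0) ≤ p / 6 := by
  have hp1 : (1 : ℝ) ≤ p := by exact_mod_cast hp
  rcases h with h | ⟨rfl, h⟩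
  · have hinner : ∀ n ∈ range N, ∑ h ∈ range N,
        (if ((p ^ m : ℕ) : ℤ) ∣ (n : ℤ) - h then 1 / (6 * (p : ℝ) ^ m) else 0)
        = 1 / (6 * (p : ℝ) ^ m) := by
      intro n hn
      have hn' := Finset.mem_range.1 hn
      rw [Finset.sum_eq_single_of_mem n hn]
      · simp
      · intro k hk hkn
        have hk' := Finset.mem_range.1 hk
        rw [if_neg]
        intro hd
        have := Int.eq_zero_of_abs_lt_dvd hd (by rw [abs_lt]; constructor <;> omega)
        omega
    rw [Finset.sum_congr rfl hinner, Finset.sum_const, Finset.card_range, nsmul_eq_mul]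
    have h' : (N : ℝ) ≤ (p : ℝ) ^ m := by exact_mod_cast h
    have hpos : (0 : ℝ) < (p : ℝ) ^ m := by positivity
    rw [mul_one_div, div_le_div_iff₀ (by positivity) (by norm_num)]
    nlinarith
  · have h' : (N : ℝ) ^ 2 ≤ p := by exact_mod_cast h
    simp
    nlinarith

lemma exists_level {p N : ℕ} (hp : 1 < p) (hN : 2 ≤ N) :
    ∃ m : ℕ, (N ≤ p ^ m ∨ m = 0 ∧ N ^ 2 ≤ p) ∧
      1 / 3 + m * (p : ℝ) ^ 2 / 6 ≤ Real.log N * (p : ℝ) ^ 2 / Real.log p := by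
  have hp1 : (2 : ℝ) ≤ p := by exact_mod_cast hp
  have hN1 : (2 : ℝ) ≤ N := by exact_mod_cast hN
  have hlp : 0 < Real.log p := Real.log_pos (by linarith)
  have hlp' : Real.log p ≤ p := (Real.log_le_sub_one_of_pos (by linarith)).trans (by linarith)
  have hlN : 2 / 3 < Real.log N :=
    lt_of_lt_of_le (by linarith [Real.log_two_gt_d9]) (Real.log_le_log (by norm_num) hN1)
  have hbase : 4 / 3 * Real.log p ≤ Real.log N * (p : ℝ) ^ 2 := by
    nlinarith [mul_nonneg (by linarith : (0 : ℝ) ≤ p) (by linarith : (0 : ℝ) ≤ p - 2)]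
  by_cases h : N ^ 2 ≤ p
  · refine ⟨0, Or.inr ⟨rfl, h⟩, ?_⟩
    rw [le_div_iff₀ hlp]
    push_cast
    nlinarith
  · refine ⟨Nat.clog p N, Or.inl (Nat.le_pow_clog hp N), ?_⟩
    have h1 : Real.log p ≤ 2 * Real.log N := by
      rw [← Nat.cast_two (R := ℝ), ← Real.log_pow]
      refine Real.log_le_log (by linarith) ?_
      exact_mod_cast (not_le.1 h).le
    have hc : 0 < Nat.clog p N := Nat.clog_pos hp hN
    obtain ⟨k, hk⟩ := Nat.exists_eq_add_of_lt hc
    have h2 : (k : ℝ) * Real.log p ≤ Real.log N := by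
      rw [← Real.log_pow]
      refine Real.log_le_log (by positivity) ?_
      have := Nat.pow_pred_clog_lt_self hp hN
      rw [hk] at this
      simp at this
      exact_mod_cast this.le
    have h3 : (Nat.clog p N : ℝ) * Real.log p ≤ 3 * Real.log N := by
      rw [hk]
      push_cast
      linarith
    rw [le_div_iff₀ hlp]
    nlinarith [mul_le_mul_of_nonneg_right h3 (sq_nonneg (p : ℝ))]

lemma sum_prod_levelKernel_le {s : ℕ} (p : Fin s → ℕ) (hp : ∀ j, 0 < p j)
    (hcop : Pairwise (Function.onFun Nat.Coprime p)) (c : Fin s → ℝ) (hc : ∀ j, 0 ≤ c j)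
    (m : Fin s → ℕ) (N : ℕ) :
    ∑ n ∈ range N, ∑ h ∈ range N,
        ∏ j, (1 + c j / 3 + c j * ∑ t ∈ range (m j), levelKernel (p j) t ((n : ℤ) - h))
      ≤ (N : ℝ) ^ 2 * ∏ j, (1 + c j / 3)
        + ∏ j, (1 + c j / 3 + c j * (m j * (p j : ℝ) ^ 2 / 6)) := by
  let φ : Fin s → ℕ → ℤ → ℝ := fun j g d =>
    match g with
    | 0 => 1 + c j / 3
    | t + 1 => c j * levelKernel (p j) t d
  let κ : Fin s → ℕ → ℝ := fun j g =>
    match g with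
    | 0 => 1 + c j / 3
    | _ + 1 => c j * ((p j : ℝ) ^ 2 / 6)
  have hκ : ∀ j g, 0 ≤ κ j g := by
    intro j g
    have := hc j
    cases g with
    | zero =>
      change 0 ≤ 1 + c j / 3
      positivity
    | succ t =>
      change 0 ≤ c j * ((p j : ℝ) ^ 2 / 6)
      positivity
  have hfour : ∀ j g, ∃ (a : ℕ → ℝ) (B : ℝ), (∀ k, 0 ≤ a k) ∧ (∀ k, a k ≤ B) ∧
      (g ≠ 0 → a 0 = 0) ∧ B * ((p j ^ g : ℕ) : ℝ) ^ 2 = κ j g ∧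
      ∀ d : ℤ, Complex.ofReal (φ j g d)
        = ∑ k ∈ range (p j ^ g), (a k : ℂ) * unitExp (k * (d / (p j ^ g : ℕ))) := by
    intro j g
    have hcj := hc j
    cases g with
    | zero =>
      refine ⟨fun _ => 1 + c j / 3, 1 + c j / 3, fun _ => by positivity, fun _ => le_rfl,
        fun h => absurd rfl h, by simp [κ], fun d => ?_⟩
      simp [φ, unitExp_zero]
    | succ t =>
      obtain ⟨a, h0, h1, h2, h3⟩ := exists_levelKernel_fourier (hp j) t
      have hpj : (0 : ℝ) < p j := by exact_mod_cast hp j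
      refine ⟨fun k => c j * a k, c j * (1 / (6 * (p j : ℝ) ^ (2 * t))),
        fun k => mul_nonneg hcj (h0 k), fun k => mul_le_mul_of_nonneg_left (h1 k) hcj,
        fun _ => by simp [h2], ?_, fun d => ?_⟩
      · simp only [κ]
        push_cast
        field_simp
        ring
      · simp only [φ]
        push_cast
        rw [h3 d, Finset.mul_sum]
        push_cast
        exact Finset.sum_congr rfl fun k _ => by ring
  choose a B ha0 haB haz hBκ hφ using hfour
  have hexp : ∀ d : ℤ, ∏ j, (1 + c j / 3 + c j * ∑ t ∈ range (m j), levelKernel (p j) t d)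
      = ∑ g ∈ Fintype.piFinset fun j => range (m j + 1), ∏ j, φ j (g j) d := fun d => by
    rw [← Finset.prod_univ_sum (fun j => range (m j + 1)) fun j g => φ j g d]
    refine Finset.prod_congr rfl fun j _ => ?_
    rw [Finset.sum_range_succ', Finset.mul_sum, add_comm]
  have hexpκ : ∏ j, (1 + c j / 3 + c j * (m j * (p j : ℝ) ^ 2 / 6))
      = ∑ g ∈ Fintype.piFinset fun j => range (m j + 1), ∏ j, κ j (g j) := by
    rw [← Finset.prod_univ_sum (fun j => range (m j + 1)) κ]
    refine Finset.prod_congr rfl fun j _ => ?_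
    rw [Finset.sum_range_succ', add_comm]
    simp only [κ, Finset.sum_const, Finset.card_range, nsmul_eq_mul]
    ring
  have hzero : (fun _ => 0) ∈ Fintype.piFinset fun j => range (m j + 1) :=
    Fintype.mem_piFinset.2 fun j => Finset.mem_range.2 (Nat.succ_pos _)
  simp_rw [hexp]
  rw [hexpκ]
  have hcomm : ∑ n ∈ range N, ∑ h ∈ range N, ∑ g ∈ Fintype.piFinset fun j => range (m j + 1),
        ∏ j, φ j (g j) ((n : ℤ) - h)
      = ∑ g ∈ Fintype.piFinset fun j => range (m j + 1), ∑ n ∈ range N, ∑ h ∈ range N,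
        ∏ j, φ j (g j) ((n : ℤ) - h) := by
    refine Eq.trans ?_ Finset.sum_comm
    exact Finset.sum_congr rfl fun n _ => Finset.sum_comm
  rw [hcomm, ← Finset.add_sum_erase _ _ hzero, ← Finset.add_sum_erase _ (fun g => ∏ j, κ j (g j)) hzero]
  have h1 : ∑ n ∈ range N, ∑ h ∈ range N, ∏ j, φ j 0 ((n : ℤ) - h)
      = (N : ℝ) ^ 2 * ∏ j, (1 + c j / 3) := by
    simp only [φ, Finset.sum_const, Finset.card_range, nsmul_eq_mul]
    ring
  have h2 : 0 ≤ ∏ j, κ j 0 := Finset.prod_nonneg fun j _ => hκ j 0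
  rw [h1]
  refine add_le_add le_rfl (le_add_of_nonneg_of_le h2 (Finset.sum_le_sum fun g hg => ?_))
  obtain ⟨j₀, hj₀⟩ := Function.ne_iff.1 (Finset.ne_of_mem_erase hg)
  refine (sum_prod_fourier_le (fun j => p j ^ g j) (fun j => pow_pos (hp j) _)
    (fun i j hij => Nat.Coprime.pow _ _ (hcop hij)) (fun j => φ j (g j)) (fun j => a j (g j))
    (fun j => hφ j (g j)) (fun j => B j (g j)) (fun j => ha0 j (g j)) (fun j => haB j (g j)) j₀
    (haz _ _ hj₀) N).trans (le_of_eq ?_)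
  rw [← Finset.prod_pow, ← Finset.prod_mul_distrib]
  exact Finset.prod_congr rfl fun j _ => hBκ j (g j)

lemma sum_prod_digitGap_lt {s : ℕ} (p : Fin s → ℕ) (hp : ∀ j, 1 < p j)
    (hcop : Pairwise (Function.onFun Nat.Coprime p)) (c : Fin s → ℝ) (hc : ∀ j, 0 ≤ c j)
    (m : Fin s → ℕ) (N : ℕ) (hm : ∀ j, N ≤ p j ^ m j ∨ m j = 0 ∧ N ^ 2 ≤ p j) :
    ∑ n ∈ range N, ∑ h ∈ range N, ∏ j, (1 + c j * (1 / 2 - digitGap (p j) (m j) ((n : ℤ) - h)))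
      < (N : ℝ) ^ 2 * ∏ j, (1 + c j / 3)
        + (∏ j, (1 + c j * (1 / 3 + m j * (p j : ℝ) ^ 2 / 6))
          + (∏ j, (1 + c j / 2)) * ∏ j, (1 + c j * p j / 6)) := by
  let F : Fin s → ℤ → ℝ := fun j d => 1 + c j * (1 / 2 - digitGap (p j) (m j) d)
  let G : Fin s → ℤ → ℝ := fun j d =>
    1 + c j / 3 + c j * ∑ t ∈ range (m j), levelKernel (p j) t d
  have hFG : ∀ j d, F j d - G j d
      = c j * if ((p j ^ m j : ℕ) : ℤ) ∣ d then 1 / (6 * (p j : ℝ) ^ m j) else 0 := fun j d => by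
    simp only [F, G]
    rw [half_sub_digitGap (by have := hp j; omega)]
    ring
  have hI : ∀ j d, (0 : ℝ) ≤ (if ((p j ^ m j : ℕ) : ℤ) ∣ d then 1 / (6 * (p j : ℝ) ^ m j) else 0)
      ∧ (if ((p j ^ m j : ℕ) : ℤ) ∣ d then 1 / (6 * (p j : ℝ) ^ m j) else 0) ≤ 1 / 6 := by
    intro j d
    have h1 : (1 : ℝ) ≤ (p j : ℝ) ^ m j := one_le_pow₀ (by exact_mod_cast (hp j).le)
    split_ifs
    · refine ⟨by positivity, ?_⟩
      exact one_div_le_one_div_of_le (by norm_num) (by linarith)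
    · norm_num
  have hG0 : ∀ j d, 0 ≤ G j d := fun j d => by
    have h1 := hFG j d
    have h2 := (digitGap_mem_Icc (hp j) (m j) d).2
    have h3 := mul_le_mul_of_nonneg_left (hI j d).2 (hc j)
    have h4 := mul_le_mul_of_nonneg_left h2 (hc j)
    have h5 := hc j
    simp only [F] at h1
    linarith
  have hpt : ∀ d, ∏ j, F j d ≤ ∏ j, G j d + (∏ j, (1 + c j / 2)) * ∑ j, (F j d - G j d) := fun d => by
    have := prod_sub_prod_le univ (fun j => F j d) (fun j => G j d) (fun j => 1 + c j / 2)
      (fun j => hG0 j d) (fun j => sub_nonneg.1 (by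
        rw [hFG]
        exact mul_nonneg (hc j) (hI j d).1)) (fun j => by
        have := mul_nonneg (hc j) (digitGap_mem_Icc (hp j) (m j) d).1
        simp only [F]
        linarith) (fun j => by linarith [hc j])
    linarith
  have hA : 0 < ∏ j, (1 + c j / 2) := Finset.prod_pos fun j _ => by linarith [hc j]
  have hB : ∑ n ∈ range N, ∑ h ∈ range N, ∑ j, (F j ((n : ℤ) - h) - G j ((n : ℤ) - h))
      < ∏ j, (1 + c j * p j / 6) := by
    have e : ∑ n ∈ range N, ∑ h ∈ range N, ∑ j, (F j ((n : ℤ) - h) - G j ((n : ℤ) - h))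
        = ∑ j, ∑ n ∈ range N, ∑ h ∈ range N, (F j ((n : ℤ) - h) - G j ((n : ℤ) - h)) := by
      refine Eq.trans ?_ Finset.sum_comm
      exact Finset.sum_congr rfl fun n _ => Finset.sum_comm
    rw [e]
    have h1 : ∀ j ∈ univ, ∑ n ∈ range N, ∑ h ∈ range N, (F j ((n : ℤ) - h) - G j ((n : ℤ) - h))
        ≤ c j * p j / 6 := fun j _ => by
      simp_rw [hFG, ← Finset.mul_sum]
      rw [mul_div_assoc]
      exact mul_le_mul_of_nonneg_left (sum_dvd_sub_le (by have := hp j; omega) (hm j)) (hc j)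
    refine (Finset.sum_le_sum h1).trans_lt ?_
    have h2 := one_add_sum_le_prod_one_add univ (fun j => c j * p j / 6) fun j => by
      have := hc j
      positivity
    linarith
  have hK := sum_prod_levelKernel_le p (fun j => (hp j).le) hcop c hc m N
  have hsplit : ∑ n ∈ range N, ∑ h ∈ range N, ∏ j, F j ((n : ℤ) - h)
      ≤ ∑ n ∈ range N, ∑ h ∈ range N, ∏ j, G j ((n : ℤ) - h) + (∏ j, (1 + c j / 2))
        * ∑ n ∈ range N, ∑ h ∈ range N, ∑ j, (F j ((n : ℤ) - h) - G j ((n : ℤ) - h)) := by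
    refine (Finset.sum_le_sum fun n _ => Finset.sum_le_sum fun h _ => hpt _).trans (le_of_eq ?_)
    simp_rw [Finset.sum_add_distrib, Finset.mul_sum]
  have hX : ∏ j, (1 + c j / 3 + c j * (m j * (p j : ℝ) ^ 2 / 6))
      = ∏ j, (1 + c j * (1 / 3 + m j * (p j : ℝ) ^ 2 / 6)) :=
    Finset.prod_congr rfl fun j _ => by ring
  have := mul_lt_mul_of_pos_left hB hA
  rw [hX] at hK
  refine hsplit.trans_lt ?_
  linarith

/-- existence of a good `p`-adic shift `σ ∈ [0,1)^s`. -/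
theorem exists_good_padic_shift
    (s N : ℕ) (hN : 2 ≤ N)
    (p : ℕ → ℕ) (hp : ∀ j < s, (p j).Prime)
    (hdist : ∀ i < s, ∀ j < s, p i = p j → i = j)
    (γ : ℕ → ℝ) (hγpos : ∀ j, 0 < γ j) (hγ1 : γ 0 ≤ 1) (hγmon : Antitone γ) :
    ∃ σ : Fin s → ℝ, (∀ j, σ j ∈ Set.Ico (0 : ℝ) 1) ∧
      sqErr s N γ (fun n j => pshift (p j.val) (radInv (p j.val) n.val) (σ j)) ≤
        1 / (N : ℝ) ^ 2 *
          ((∏ j ∈ Finset.range s, (1 + γ j * Real.log N * (p j : ℝ) ^ 2 / Real.log (p j))) +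
            (∏ j ∈ Finset.range s, (1 + γ j / 2)) *
              ∏ j ∈ Finset.range s, (1 + γ j * (p j : ℝ) / 6)) := by
  have hp1 : ∀ j : Fin s, 1 < p j.val := fun j => (hp j.val j.isLt).one_lt
  have hγle : ∀ j, γ j ≤ 1 := fun j => (hγmon (Nat.zero_le j)).trans hγ1
  have hcop : Pairwise (Function.onFun Nat.Coprime fun j : Fin s => p j.val) := fun i j hij =>
    (Nat.coprime_primes (hp i.val i.isLt) (hp j.val j.isLt)).2 fun h =>
      hij (Fin.ext (hdist _ i.isLt _ j.isLt h))
  choose m hm hmle using fun j : Fin s => exists_level (hp1 j) hN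
  have hmain := sum_prod_digitGap_lt (fun j : Fin s => p j.val) hp1 hcop (fun j => γ j.val)
    (fun j => (hγpos j.val).le) m N hm
  have hle : ∏ j : Fin s, (1 + γ j.val * (1 / 3 + m j * (p j.val : ℝ) ^ 2 / 6))
      ≤ ∏ j : Fin s, (1 + γ j.val * Real.log N * (p j.val : ℝ) ^ 2 / Real.log (p j.val)) := by
    refine Finset.prod_le_prod (fun j _ => ?_) fun j _ => ?_
    · have := (hγpos j.val).le
      positivity
    · have e : γ j.val * Real.log N * (p j.val : ℝ) ^ 2 / Real.log (p j.val)
          = γ j.val * (Real.log N * (p j.val : ℝ) ^ 2 / Real.log (p j.val)) := by ring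
      have := mul_le_mul_of_nonneg_left (hmle j) (hγpos j.val).le
      linarith
  have hN0 : (0 : ℝ) < N := by exact_mod_cast (by omega : 0 < N)
  obtain ⟨σ, hσ, h⟩ := exists_shift_sqErr_lt (N := N) (fun j : Fin s => p j.val) hp1 γ
    (fun j => (hγpos j).le) hγle m
    (1 / (N : ℝ) ^ 2 *
      ((∏ j ∈ Finset.range s, (1 + γ j * Real.log N * (p j : ℝ) ^ 2 / Real.log (p j))) +
        (∏ j ∈ Finset.range s, (1 + γ j / 2)) *
          ∏ j ∈ Finset.range s, (1 + γ j * (p j : ℝ) / 6))) (by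
    simp only [Finset.prod_range]
    have e : ∑ n : Fin N, ∑ h : Fin N, ∏ j : Fin s,
          (1 + γ j.val * (1 / 2 - digitGap (p j.val) (m j) ((n.val : ℤ) - h.val)))
        = ∑ n ∈ range N, ∑ h ∈ range N, ∏ j : Fin s,
          (1 + γ j.val * (1 / 2 - digitGap (p j.val) (m j) ((n : ℤ) - h))) := by
      simp only [Finset.sum_range]
    rw [e, Finset.sum_const, Finset.card_univ, Fintype.card_fin, nsmul_eq_mul, ← mul_assoc,
      div_mul_cancel₀ _ hN0.ne']
    have h1 := mul_lt_mul_of_pos_left hmain (by positivity : 0 < 1 / (N : ℝ) ^ 2)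
    have h2 := mul_le_mul_of_nonneg_left hle (by positivity : 0 ≤ 1 / (N : ℝ) ^ 2)
    have h3 : 1 / (N : ℝ) ^ 2 * ((N : ℝ) ^ 2 * ∏ j : Fin s, (1 + γ j.val / 3))
        = ∏ j : Fin s, (1 + γ j.val / 3) := by
      field_simp
    rw [mul_add, h3, mul_add] at h1
    rw [mul_add]
    linarith)
  exact ⟨σ, hσ, h.le⟩
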